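/- Let S = {(1,0),(−1,0),(0,1),(0,−1)} (the simple walk, Model 1). Then the interacting generating function G_S(t;a,b) ∈ ℚ[a,b][[t]] is a ratio of D-finite series: there exist D-finite power series F, H ∈ ℚ[a,b][[t]] with H ≠ 0 such that H·G_S(t;a,b) = F. -/

import Mathlib

open PowerSeries

/-- A quarter-plane loop of length `n` with steps in `S`: a sequence of points of
`ℤ≥0 × ℤ≥0` (encoded as `ℕ × ℕ`) starting and ending at the origin, with successive
differences in `S`. -/
def IsQPLoop (S : Set (ℤ × ℤ)) (n : ℕ) (w : Fin (n + 1) → ℕ × ℕ) : Prop :=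
  w 0 = (0, 0) ∧ w (Fin.last n) = (0, 0) ∧
    ∀ i : Fin n, (((w i.succ).1 : ℤ) - ((w i.castSucc).1 : ℤ),
      ((w i.succ).2 : ℤ) - ((w i.castSucc).2 : ℤ)) ∈ S

/-- The number of visits of `w` to the horizontal boundary: indices `1 ≤ i ≤ n`
with the second coordinate of `w i` equal to `0`. -/
def hvisits {n : ℕ} (w : Fin (n + 1) → ℕ × ℕ) : ℕ :=
  (Finset.univ.filter fun i : Fin (n + 1) => 0 < (i : ℕ) ∧ (w i).2 = 0).card

/-- The number of visits of `w` to the vertical boundary: indices `1 ≤ i ≤ n`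
with the first coordinate of `w i` equal to `0`. -/
def vvisits {n : ℕ} (w : Fin (n + 1) → ℕ × ℕ) : ℕ :=
  (Finset.univ.filter fun i : Fin (n + 1) => 0 < (i : ℕ) ∧ (w i).1 = 0).card

/-- The interacting generating function `G_S(t;a,b) = Σ_n t^n Σ_w a^(h(w)) b^(v(w))`,
the inner sum over all quarter-plane loops of length `n` with steps in `S`. -/
noncomputable def loopGF (S : Set (ℤ × ℤ)) {R : Type*} [CommRing R] (a b : R) :
    PowerSeries R :=
  PowerSeries.mk fun n =>
    ∑ᶠ w : {w : Fin (n + 1) → ℕ × ℕ // IsQPLoop S n w}, a ^ hvisits w.1 * b ^ vvisits w.1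

/-- A power series `F ∈ R[[t]]` is D-finite if there are polynomials `p₀, …, p_m`,
not all zero, with `Σ pᵢ · F⁽ⁱ⁾ = 0`, where `F⁽ⁱ⁾` is the `i`-th formal derivative. -/
def IsDFinite {R : Type*} [CommRing R] (F : PowerSeries R) : Prop :=
  ∃ (m : ℕ) (p : Fin (m + 1) → Polynomial R), (∃ i, p i ≠ 0) ∧
    ∑ i : Fin (m + 1), (p i : PowerSeries R) * (PowerSeries.derivativeFun)^[(i : ℕ)] F = 0

/-- The sum of `ψ` over the lattice neighbours of `(i, j)` in the quarter plane. -/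
def nbrSum {A : Type*} [AddCommMonoid A] (ψ : ℕ → ℕ → A) (i j : ℕ) : A :=
  ψ (i + 1) j + ψ i (j + 1) + (if i = 0 then 0 else ψ (i - 1) j) +
    (if j = 0 then 0 else ψ i (j - 1))

/-- The weight collected when a walk arrives at `(i, j)`. -/
def bdryWeight {R : Type*} [CommRing R] (a b : R) (i j : ℕ) : R :=
  (if j = 0 then a else 1) * (if i = 0 then b else 1)

/-- The total weight of the quarter-plane walks of length `n` from the origin to `(i, j)`. -/
def walkWeight {R : Type*} [CommRing R] (a b : R) : ℕ → ℕ → ℕ → R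
  | 0, i, j => if i = 0 ∧ j = 0 then 1 else 0
  | n + 1, i, j => bdryWeight a b i j * nbrSum (walkWeight a b n) i j

/-- `ψ` solves the weighted walk recurrence with source `c` at the origin. -/
def IsGreen {R : Type*} [CommRing R] (a b : R) (c : R⟦X⟧) (ψ : ℕ → ℕ → R⟦X⟧) : Prop :=
  ∀ i j, ψ i j = (if i = 0 ∧ j = 0 then c else 0) + C (bdryWeight a b i j) * (X * nbrSum ψ i j)

/-- The lattice neighbours of `v` in the quarter plane. -/
def nbrs (v : ℕ × ℕ) : Finset (ℕ × ℕ) :=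
  {(v.1 + 1, v.2), (v.1, v.2 + 1)} ∪ (if v.1 = 0 then ∅ else {(v.1 - 1, v.2)}) ∪
    (if v.2 = 0 then ∅ else {(v.1, v.2 - 1)})

theorem mem_nbrs (u v : ℕ × ℕ) : u ∈ nbrs v ↔
    (((v.1 : ℤ) - (u.1 : ℤ), (v.2 : ℤ) - (u.2 : ℤ)) ∈
      ({((1:ℤ), (0:ℤ)), (-1, 0), (0, 1), (0, -1)} : Set (ℤ × ℤ))) := by
  obtain ⟨i, j⟩ := v
  obtain ⟨k, l⟩ := u
  unfold nbrs
  split_ifs <;> simp [Prod.ext_iff] <;> omega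

theorem nbrSum_eq_sum {A : Type*} [AddCommMonoid A] (ψ : ℕ → ℕ → A) (i j : ℕ) :
    nbrSum ψ i j = ∑ u ∈ nbrs (i, j), ψ u.1 u.2 := by
  unfold nbrSum nbrs
  rcases i with _ | i <;> rcases j with _ | j <;>
  simp [Finset.sum_insert, add_assoc]

/-- The walks of length `n` from the origin to `v`. -/
def IsWalkTo (n : ℕ) (v : ℕ × ℕ) (w : Fin (n + 1) → ℕ × ℕ) : Prop :=
  w 0 = (0, 0) ∧ w (Fin.last n) = v ∧ ∀ i : Fin n, w i.castSucc ∈ nbrs (w i.succ)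

theorem isWalkTo_snoc {n : ℕ} {u v : ℕ × ℕ} {w : Fin (n + 1) → ℕ × ℕ} (hw : IsWalkTo n u w)
    (huv : u ∈ nbrs v) : IsWalkTo (n + 1) v (Fin.snoc w v : Fin (n + 2) → ℕ × ℕ) := by
  obtain ⟨h0, h1, h2⟩ := hw
  refine ⟨?_, Fin.snoc_last _ _, fun i => ?_⟩
  · rw [← Fin.castSucc_zero, Fin.snoc_castSucc, h0]
  · refine Fin.lastCases ?_ (fun k => ?_) i
    · rw [Fin.snoc_castSucc, Fin.succ_last, Fin.snoc_last, h1]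
      exact huv
    · rw [Fin.snoc_castSucc, Fin.succ_castSucc, Fin.snoc_castSucc]
      exact h2 k

theorem isWalkTo_init {n : ℕ} {v : ℕ × ℕ} {w : Fin (n + 2) → ℕ × ℕ} (hw : IsWalkTo (n + 1) v w) :
    w (Fin.last n).castSucc ∈ nbrs v ∧ IsWalkTo n (w (Fin.last n).castSucc) (Fin.init w) := by
  obtain ⟨h0, h1, h2⟩ := hw
  refine ⟨?_, ?_, rfl, fun k => ?_⟩
  · have := h2 (Fin.last n)
    rwa [Fin.succ_last, h1] at this
  · simpa [Fin.init] using h0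
  · have := h2 k.castSucc
    rwa [Fin.succ_castSucc] at this

/-- The finset of walks of length `n` from the origin to `v`. -/
def walksTo : (n : ℕ) → ℕ × ℕ → Finset (Fin (n + 1) → ℕ × ℕ)
  | 0, v => if v = (0, 0) then {fun _ => (0, 0)} else ∅
  | n + 1, v => (nbrs v).biUnion fun u =>
      (walksTo n u).image fun w => (Fin.snoc w v : Fin (n + 2) → ℕ × ℕ)

theorem mem_walksTo (n : ℕ) (v : ℕ × ℕ) (w : Fin (n + 1) → ℕ × ℕ) :
    w ∈ walksTo n v ↔ IsWalkTo n v w := by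
  induction n generalizing v with
  | zero =>
    unfold walksTo IsWalkTo
    split_ifs with h
    · subst h
      simp only [Finset.mem_singleton]
      refine ⟨fun h => by subst h; simp, fun h => funext fun i => ?_⟩
      rw [Fin.fin_one_eq_zero i, h.1]
    · simp only [Finset.notMem_empty, false_iff]
      rintro ⟨h0, h1, -⟩
      exact h (h1.symm.trans h0)
  | succ n ih =>
    simp only [walksTo, Finset.mem_biUnion, Finset.mem_image]
    constructor
    · rintro ⟨u, hu, w', hw', rfl⟩
      exact isWalkTo_snoc ((ih u w').1 hw') hu
    · intro hw
      obtain ⟨h1, h2⟩ := isWalkTo_init hw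
      refine ⟨_, h1, Fin.init w, (ih _ _).2 h2, ?_⟩
      rw [← hw.2.1]
      exact Fin.snoc_init_self w

theorem hvisits_snoc {n : ℕ} (w : Fin (n + 1) → ℕ × ℕ) (v : ℕ × ℕ) :
    hvisits (Fin.snoc w v : Fin (n + 2) → ℕ × ℕ) = hvisits w + if v.2 = 0 then 1 else 0 := by
  simp only [hvisits, Finset.card_filter]
  rw [Fin.sum_univ_castSucc]
  simp

theorem vvisits_snoc {n : ℕ} (w : Fin (n + 1) → ℕ × ℕ) (v : ℕ × ℕ) :
    vvisits (Fin.snoc w v : Fin (n + 2) → ℕ × ℕ) = vvisits w + if v.1 = 0 then 1 else 0 := by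
  simp only [vvisits, Finset.card_filter]
  rw [Fin.sum_univ_castSucc]
  simp

theorem sum_walksTo {R : Type*} [CommRing R] (a b : R) (n : ℕ) (v : ℕ × ℕ) :
    ∑ w ∈ walksTo n v, a ^ hvisits w * b ^ vvisits w = walkWeight a b n v.1 v.2 := by
  induction n generalizing v with
  | zero =>
    have hh : hvisits (fun _ : Fin 1 => ((0 : ℕ), (0 : ℕ))) = 0 := by simp [hvisits]
    have hv : vvisits (fun _ : Fin 1 => ((0 : ℕ), (0 : ℕ))) = 0 := by simp [vvisits]
    unfold walksTo walkWeight
    by_cases h : v = (0, 0)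
    · subst h
      simp [hh, hv]
    · have h' : ¬ (v.1 = 0 ∧ v.2 = 0) := fun h' => h (Prod.ext h'.1 h'.2)
      simp [h, h']
  | succ n ih =>
    rw [walksTo, walkWeight, nbrSum_eq_sum, Finset.sum_biUnion, Finset.mul_sum]
    · refine Finset.sum_congr rfl fun u _ => ?_
      rw [Finset.sum_image, ← ih, Finset.mul_sum]
      · refine Finset.sum_congr rfl fun w _ => ?_
        rw [hvisits_snoc, vvisits_snoc, bdryWeight]
        split_ifs <;> ring
      · intro w _ w' _ h
        exact (Fin.snoc_injective2 h).1
    · intro u _ u' _ huu'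
      rw [Function.onFun, Finset.disjoint_left]
      intro w hw hw'
      obtain ⟨w₁, h₁, rfl⟩ := Finset.mem_image.1 hw
      obtain ⟨w₂, h₂, h⟩ := Finset.mem_image.1 hw'
      obtain rfl := (Fin.snoc_injective2 h).1
      exact huu' (((mem_walksTo _ _ _).1 h₁).2.1.symm.trans ((mem_walksTo _ _ _).1 h₂).2.1)

theorem loopGF_eq {R : Type*} [CommRing R] (a b : R) :
    loopGF ({((1:ℤ), (0:ℤ)), (-1, 0), (0, 1), (0, -1)} : Set (ℤ × ℤ)) a b =
      PowerSeries.mk fun n => walkWeight a b n 0 0 := by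
  unfold loopGF
  congr 1
  funext n
  rw [← sum_walksTo a b n (0, 0), ← finsum_mem_coe_finset, ← finsum_set_coe_eq_finsum_mem]
  have h : {w : Fin (n + 1) → ℕ × ℕ | IsQPLoop
      ({((1:ℤ), (0:ℤ)), (-1, 0), (0, 1), (0, -1)} : Set (ℤ × ℤ)) n w} = ↑(walksTo n (0, 0)) := by
    ext w
    rw [Finset.mem_coe, mem_walksTo, Set.mem_ofPred_eq, IsQPLoop, IsWalkTo]
    simp only [mem_nbrs]
  rw [← h]
  rfl

section Green

variable {R : Type*} [CommRing R]

theorem isGreen_walkWeight (a b : R) :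
    IsGreen a b 1 fun i j => PowerSeries.mk fun n => walkWeight a b n i j := by
  intro i j
  ext n
  rcases n with _ | n
  · simp only [coeff_mk, map_add, walkWeight, coeff_C_mul, coeff_zero_X_mul, mul_zero, add_zero]
    split_ifs <;> simp
  · simp only [coeff_mk, map_add, walkWeight, coeff_C_mul, coeff_succ_X_mul, nbrSum]
    split_ifs <;> simp [coeff_one]

theorem IsGreen.eq_zero {a b : R} {ψ : ℕ → ℕ → R⟦X⟧} (h : IsGreen a b 0 ψ) (i j : ℕ) :
    ψ i j = 0 := by
  ext n
  rw [map_zero]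
  induction n generalizing i j with
  | zero => rw [h i j]; simp
  | succ n ih =>
    rw [h i j]
    simp only [ite_self, zero_add, coeff_C_mul, coeff_succ_X_mul, nbrSum, map_add, ih]
    split_ifs <;> simp [ih]

theorem IsGreen.unique {a b : R} {c : R⟦X⟧} {ψ χ : ℕ → ℕ → R⟦X⟧} (hψ : IsGreen a b c ψ)
    (hχ : IsGreen a b 1 χ) (i j : ℕ) : ψ i j = c * χ i j := by
  have h : IsGreen a b 0 fun i j => ψ i j - c * χ i j := by
    intro i j
    have h1 := hψ i j
    have h2 := hχ i j
    simp only [nbrSum] at h1 h2 ⊢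
    rw [h1, h2]
    split_ifs <;> ring
  exact sub_eq_zero.1 (h.eq_zero i j)

theorem IsGreen.swap {a b : R} {c : R⟦X⟧} {ψ : ℕ → ℕ → R⟦X⟧} (h : IsGreen a b c ψ) :
    IsGreen b a c fun i j => ψ j i := by
  intro i j
  have h1 := h j i
  simp only [nbrSum, bdryWeight] at h1 ⊢
  rw [h1]
  simp only [and_comm (a := j = 0), mul_comm (ite (i = 0) a 1)]
  ring

/-- A discrete Darboux transformation removes the weight of the horizontal boundary. -/
theorem IsGreen.darboux {a b : R} {ψ : ℕ → ℕ → R⟦X⟧} (h : IsGreen a b 1 ψ) :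
    IsGreen 1 b (X * (1 - C ((a - 1) * (b - 1)) * ψ 0 0))
      fun i j => C a * X * ψ i j - C (a - 1) * ψ i (j + 1) := by
  intro i j
  have h0 := h i j
  have h1 := h i (j + 1)
  simp only [nbrSum, bdryWeight] at h0 h1 ⊢
  rcases i with _ | i <;> rcases j with _ | j <;> simp at h0 h1 ⊢
  · linear_combination X * h0 - (C a - 1) * h1
  · linear_combination (C a * X) * h0 - (C a - 1) * h1
  · linear_combination X * h0 - (C a - 1) * h1
  · linear_combination (C a * X) * h0 - (C a - 1) * h1

theorem IsGreen.mul_eq {a b : R} {g ga gb : ℕ → ℕ → R⟦X⟧} (h : IsGreen a b 1 g)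
    (hb : IsGreen 1 b 1 gb) (ha : IsGreen 1 a 1 ga) :
    (C ((a - 1) * (b - 1)) - C (a * b * (a * (b - 1) + b * (a - 1))) * X ^ 2 -
      C (a * b * ((a - 1) * (b - 1))) * X ^ 2 *
        (C (a - 1) * ga 0 0 + C (b - 1) * gb 0 0)) * g 0 0 =
    C ((a - 1) * (b - 1)) -
      C (a * b) * X ^ 2 * (C (a - 1) * ga 0 0 + C (b - 1) * gb 0 0) := by
  have h0 := h 0 0
  have h1 := h.darboux.unique hb 0 0
  have h2 := h.swap.darboux.unique ha 0 0
  simp [nbrSum, bdryWeight] at h0 h1 h2 ⊢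
  linear_combination (C a - 1) * (C b - 1) * h0 -
    C a * C b * X * (C b - 1) * h1 - C a * C b * X * (C a - 1) * h2

end Green

/-- Laurent polynomials in two variables over `R`. -/
abbrev Laurent₂ (R : Type*) [CommRing R] : Type _ := AddMonoidAlgebra R (ℤ × ℤ)

section Extraction

variable {R : Type*} [CommRing R]

/-- The monomial `x^u y^v`, `m = (u, v)`, as a constant power series. -/
noncomputable def mono (R : Type*) [CommRing R] (m : ℤ × ℤ) : (Laurent₂ R)⟦X⟧ :=
  C (AddMonoidAlgebra.single m 1)

theorem mono_mul_mono (m m' : ℤ × ℤ) : mono R m * mono R m' = mono R (m + m') := by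
  simp [mono, ← map_mul, AddMonoidAlgebra.single_mul_single]

theorem mono_zero : mono R 0 = 1 := by
  simp [mono, ← AddMonoidAlgebra.one_def]

/-- Extraction of the coefficient of `x^u y^v`, `m = (u, v)`. -/
noncomputable def extract (m : ℤ × ℤ) : (Laurent₂ R)⟦X⟧ →ₗ[R] R⟦X⟧ where
  toFun g := PowerSeries.mk fun n => (coeff n g).coeff m
  map_add' f g := by ext n; simp
  map_smul' r g := by ext n; simp

theorem coeff_extract (m : ℤ × ℤ) (g : (Laurent₂ R)⟦X⟧) (n : ℕ) :
    coeff n (extract m g) = (coeff n g).coeff m := by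
  simp [extract]

theorem extract_X_mul (m : ℤ × ℤ) (g : (Laurent₂ R)⟦X⟧) :
    extract m (X * g) = X * extract m g := by
  ext n
  cases n <;> simp [coeff_extract, coeff_succ_X_mul, coeff_zero_X_mul]

theorem extract_X_pow_mul (m : ℤ × ℤ) (g : (Laurent₂ R)⟦X⟧) (i : ℕ) :
    extract m (X ^ i * g) = X ^ i * extract m g := by
  induction i with
  | zero => simp
  | succ i ih => rw [pow_succ', mul_assoc, extract_X_mul, ih, ← mul_assoc, ← pow_succ']

theorem extract_mono_mul (m e : ℤ × ℤ) (g : (Laurent₂ R)⟦X⟧) :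
    extract m (mono R e * g) = extract (m - e) g := by
  ext n
  rw [coeff_extract, coeff_extract, mono, coeff_C_mul, AddMonoidAlgebra.coeff_single_mul_apply,
    one_mul, neg_add_eq_sub]

theorem extract_derivative (m : ℤ × ℤ) (g : (Laurent₂ R)⟦X⟧) :
    extract m (derivative (Laurent₂ R) g) = derivative R (extract m g) := by
  ext n
  have h (f : Laurent₂ R) : (f * ((n : Laurent₂ R) + 1)).coeff m = f.coeff m * ((n : R) + 1) := by
    rw [← Nat.cast_succ, ← Nat.cast_succ, mul_comm, ← nsmul_eq_mul, mul_comm, ← nsmul_eq_mul,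
      AddMonoidAlgebra.coeff_smul_apply]
  rw [coeff_extract, coeff_derivative, coeff_derivative, coeff_extract, h]

theorem extract_mono (m e : ℤ × ℤ) : extract m (mono R e) = if m = e then 1 else 0 := by
  ext n
  rw [coeff_extract, mono, coeff_C]
  split_ifs with h1 h2 h2
  · simp [h1, h2, coeff_one]
  · simp [h1, Ne.symm h2]
  · simp [coeff_one, h1]
  · simp

/-- The derivation of Laurent polynomials `x^m ↦ w(m) x^(m + e)`. -/
noncomputable def laurentDerivHom (w : ℤ × ℤ →+ ℤ) (e : ℤ × ℤ) : Laurent₂ R →+ Laurent₂ R :=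
  (Finsupp.liftAddHom fun m : ℤ × ℤ =>
    (AddMonoidAlgebra.singleAddHom (m + e)).comp (AddMonoidHom.mulLeft ((w m : ℤ) : R))).comp
      AddMonoidAlgebra.coeffAddEquiv.toAddMonoidHom

theorem laurentDerivHom_single (w : ℤ × ℤ →+ ℤ) (e m : ℤ × ℤ) (r : R) :
    laurentDerivHom w e (AddMonoidAlgebra.single m r)
      = AddMonoidAlgebra.single (m + e) ((w m : R) * r) := by
  simp [laurentDerivHom, AddMonoidAlgebra.singleAddHom]

theorem laurentDerivHom_mul (w : ℤ × ℤ →+ ℤ) (e : ℤ × ℤ) (f g : Laurent₂ R) :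
    laurentDerivHom w e (f * g) = f * laurentDerivHom w e g + g * laurentDerivHom w e f := by
  induction f using AddMonoidAlgebra.induction_linear with
  | zero => simp
  | add f f' hf hf' => rw [add_mul, map_add, hf, hf', map_add]; ring
  | single m r =>
    induction g using AddMonoidAlgebra.induction_linear with
    | zero => simp
    | add g g' hg hg' => rw [mul_add, map_add, hg, hg', map_add]; ring
    | single m' r' =>
      simp only [laurentDerivHom_single, AddMonoidAlgebra.single_mul_single]
      rw [show m + (m' + e) = m + m' + e by abel, show m' + (m + e) = m + m' + e by abel,
        ← AddMonoidAlgebra.single_add, map_add]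
      congr 1
      push_cast
      ring

theorem coeff_laurentDerivHom (w : ℤ × ℤ →+ ℤ) (e m : ℤ × ℤ) (f : Laurent₂ R) :
    (laurentDerivHom w e f).coeff m = (w (m - e) : R) * f.coeff (m - e) := by
  induction f using AddMonoidAlgebra.induction_linear with
  | zero => simp
  | add f f' hf hf' => simp [hf, hf', mul_add]
  | single m' r =>
    rw [laurentDerivHom_single]
    by_cases h : m' = m - e
    · subst h; simp
    · have : m' + e ≠ m := fun h' => h (by rw [← h']; abel)
      simp [h, this]

/-- The coefficientwise extension of `laurentDerivHom` to power series. -/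
noncomputable def laurentDeriv (w : ℤ × ℤ →+ ℤ) (e : ℤ × ℤ) :
    Derivation R (Laurent₂ R)⟦X⟧ (Laurent₂ R)⟦X⟧ :=
  Derivation.mk'
    { toFun := fun g => PowerSeries.mk fun n => laurentDerivHom w e (coeff n g)
      map_add' := fun f g => by ext n; simp
      map_smul' := fun r g => by
        ext n
        simp [coeff_laurentDerivHom, mul_left_comm] }
    fun f g => by
      ext1 n
      simp only [LinearMap.coe_mk, AddHom.coe_mk, coeff_mk, smul_eq_mul, map_add, coeff_mul,
        map_sum, laurentDerivHom_mul, Finset.sum_add_distrib]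
      congr 1
      rw [← Finset.Nat.sum_antidiagonal_swap]
      rfl

theorem coeff_laurentDeriv (w : ℤ × ℤ →+ ℤ) (e : ℤ × ℤ) (g : (Laurent₂ R)⟦X⟧) (n : ℕ) :
    coeff n (laurentDeriv w e g) = laurentDerivHom w e (coeff n g) :=
  coeff_mk n fun n => laurentDerivHom w e (coeff n g)

theorem laurentDeriv_mono (w : ℤ × ℤ →+ ℤ) (e m : ℤ × ℤ) :
    laurentDeriv w e (mono R m) = w m • mono R (m + e) := by
  refine PowerSeries.ext fun n => ?_
  rw [coeff_laurentDeriv, map_zsmul, mono, mono, coeff_C, coeff_C]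
  split_ifs
  · rw [laurentDerivHom_single, AddMonoidAlgebra.smul_single, zsmul_eq_mul]
  · simp

theorem laurentDeriv_X (w : ℤ × ℤ →+ ℤ) (e : ℤ × ℤ) :
    laurentDeriv w e (X : (Laurent₂ R)⟦X⟧) = 0 := by
  refine PowerSeries.ext fun n => ?_
  rw [coeff_laurentDeriv, coeff_X]
  split_ifs
  · simp [AddMonoidAlgebra.one_def, laurentDerivHom_single]
  · simp

theorem extract_laurentDeriv (w : ℤ × ℤ →+ ℤ) (e m : ℤ × ℤ) (g : (Laurent₂ R)⟦X⟧) :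
    extract m (laurentDeriv w e g) = w (m - e) • extract (m - e) g := by
  ext n
  rw [coeff_extract, coeff_laurentDeriv, coeff_laurentDerivHom, map_zsmul, coeff_extract,
    zsmul_eq_mul]

end Extraction

section Boxes

variable {R : Type*} [CommRing R]

/-- The monomials `x^u y^v t^k` with `|u|, |v|, k ≤ n`. -/
noncomputable def boxMonomials (R : Type*) [CommRing R] (n : ℕ) : Set (Laurent₂ R)⟦X⟧ :=
  (fun p : ℕ × ℤ × ℤ => X ^ p.1 * mono R p.2) ''
    (Finset.range (n + 1) ×ˢ Finset.Icc (-n : ℤ) n ×ˢ Finset.Icc (-n : ℤ) n : Finset _)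

/-- The `R`-module of Laurent polynomials with exponents bounded by `n`. -/
noncomputable def box (R : Type*) [CommRing R] (n : ℕ) : Submodule R (Laurent₂ R)⟦X⟧ :=
  Submodule.span R (boxMonomials R n)

theorem monomial_mem_box {k n : ℕ} {m : ℤ × ℤ} (hk : k ≤ n) (h1 : |m.1| ≤ n) (h2 : |m.2| ≤ n) :
    X ^ k * mono R m ∈ box R n := by
  refine Submodule.subset_span ⟨(k, m), ?_, rfl⟩
  rw [abs_le] at h1 h2
  simp only [Finset.coe_product, Set.mem_prod, Finset.mem_coe, Finset.mem_range, Finset.mem_Icc]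
  exact ⟨by omega, h1, h2⟩

theorem box_induction {n : ℕ} {P : (Laurent₂ R)⟦X⟧ → Prop} (zero : P 0)
    (add : ∀ f g, P f → P g → P (f + g)) (smul : ∀ (r : R) f, P f → P (r • f))
    (mon : ∀ (k : ℕ) (m : ℤ × ℤ), k ≤ n → |m.1| ≤ n → |m.2| ≤ n → P (X ^ k * mono R m))
    {f : (Laurent₂ R)⟦X⟧} (hf : f ∈ box R n) : P f := by
  refine Submodule.span_induction ?_ zero (fun _ _ _ _ => add _ _) (fun r _ _ => smul r _) hf
  rintro _ ⟨⟨k, m⟩, h, rfl⟩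
  simp only [Finset.coe_product, Set.mem_prod, Finset.mem_coe, Finset.mem_range,
    Finset.mem_Icc] at h
  exact mon k m (by omega) (abs_le.2 h.2.1) (abs_le.2 h.2.2)

theorem box_mono {n n' : ℕ} (h : n ≤ n') : box R n ≤ box R n' := fun _ hf =>
  box_induction (zero_mem _) (fun _ _ => add_mem) (fun r _ => Submodule.smul_mem _ r)
    (fun k m hk h1 h2 => monomial_mem_box (hk.trans h) (h1.trans (by exact_mod_cast h))
      (h2.trans (by exact_mod_cast h))) hf

theorem mul_mem_box {n n' : ℕ} {f g : (Laurent₂ R)⟦X⟧} (hf : f ∈ box R n) (hg : g ∈ box R n') :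
    f * g ∈ box R (n + n') := by
  refine box_induction (P := fun f => f * g ∈ box R (n + n')) (by simp)
    (fun _ _ h h' => by rw [add_mul]; exact add_mem h h')
    (fun r _ h => by rw [smul_mul_assoc]; exact Submodule.smul_mem _ r h) (fun k m hk h1 h2 => ?_) hf
  refine box_induction (P := fun g => _ * g ∈ box R (n + n')) (by simp)
    (fun _ _ h h' => by rw [mul_add]; exact add_mem h h')
    (fun r _ h => by rw [mul_smul_comm]; exact Submodule.smul_mem _ r h)
    (fun k' m' hk' h1' h2' => ?_) hg
  rw [show X ^ k * mono R m * (X ^ k' * mono R m') = X ^ (k + k') * mono R (m + m') by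
    rw [← mono_mul_mono, pow_add]; ring]
  exact monomial_mem_box (by omega) (by push_cast; exact (abs_add_le _ _).trans (by gcongr))
    (by push_cast; exact (abs_add_le _ _).trans (by gcongr))

theorem one_mem_box : (1 : (Laurent₂ R)⟦X⟧) ∈ box R 0 := by
  simpa [mono_zero] using monomial_mem_box (R := R) (k := 0) (n := 0) (m := 0)

theorem pow_mem_box {n : ℕ} {f : (Laurent₂ R)⟦X⟧} (hf : f ∈ box R n) (k : ℕ) :
    f ^ k ∈ box R (k * n) := by
  induction k with
  | zero => simpa using one_mem_box
  | succ k ih => rw [pow_succ, add_mul, one_mul]; exact mul_mem_box ih hf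

/-- The derivations raising the exponents of Laurent polynomials by at most one. -/
def IsBoxDerivation (δ : Derivation R (Laurent₂ R)⟦X⟧ (Laurent₂ R)⟦X⟧) : Prop :=
  ∀ n, ∀ f ∈ box R n, δ f ∈ box R (n + 1)

theorem isBoxDerivation_of_monomial {δ : Derivation R (Laurent₂ R)⟦X⟧ (Laurent₂ R)⟦X⟧}
    (h : ∀ (n k : ℕ) (m : ℤ × ℤ), k ≤ n → |m.1| ≤ n → |m.2| ≤ n →
      δ (X ^ k * mono R m) ∈ box R (n + 1)) : IsBoxDerivation δ := fun n f hf =>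
  box_induction (P := fun f => δ f ∈ box R (n + 1)) (by simp)
    (fun _ _ h h' => by rw [map_add]; exact add_mem h h')
    (fun r _ h => by rw [Derivation.map_smul]; exact Submodule.smul_mem _ r h) (h n) hf

theorem isBoxDerivation_laurentDeriv (w : ℤ × ℤ →+ ℤ) {e : ℤ × ℤ} (h1 : |e.1| ≤ 1)
    (h2 : |e.2| ≤ 1) : IsBoxDerivation (laurentDeriv (R := R) w e) := by
  refine isBoxDerivation_of_monomial fun n k m hk hm1 hm2 => ?_
  rw [Derivation.leibniz, Derivation.leibniz_pow, laurentDeriv_X, laurentDeriv_mono]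
  simp only [mul_zero, smul_zero, add_zero, smul_eq_mul, mul_smul_comm]
  refine zsmul_mem (monomial_mem_box (R := R) (by omega) ?_ ?_) _
  · push_cast; exact (abs_add_le _ _).trans (by gcongr)
  · push_cast; exact (abs_add_le _ _).trans (by gcongr)

/-- The derivation `∂/∂t` over the ring `R`. -/
noncomputable def tDeriv (R : Type*) [CommRing R] :
    Derivation R (Laurent₂ R)⟦X⟧ (Laurent₂ R)⟦X⟧ :=
  (derivative (Laurent₂ R)).restrictScalars R

theorem isBoxDerivation_tDeriv : IsBoxDerivation (tDeriv R) := by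
  refine isBoxDerivation_of_monomial fun n k m hk hm1 hm2 => ?_
  have h : tDeriv R (mono R m) = 0 := derivative_C
  have h' : tDeriv R (X : (Laurent₂ R)⟦X⟧) = 1 := derivative_X
  rw [Derivation.leibniz, Derivation.leibniz_pow, h, h']
  simp only [mul_zero, zero_add, smul_eq_mul, mul_one, mul_smul_comm]
  rw [mul_comm (mono R m)]
  exact nsmul_mem (monomial_mem_box (by omega) (by push_cast; omega) (by push_cast; omega)) _

theorem IsBoxDerivation.pow_mul_mem {δ : Derivation R (Laurent₂ R)⟦X⟧ (Laurent₂ R)⟦X⟧}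
    (h : IsBoxDerivation δ) {D g : (Laurent₂ R)⟦X⟧} {e s m : ℕ} (hD : D ∈ box R m)
    (hg : D ^ e * g ∈ box R s) : D ^ (e + 1) * δ g ∈ box R (s + (m + 1)) := by
  have key : D ^ (e + 1) * δ g = D * δ (D ^ e * g) - e • (δ D * (D ^ e * g)) := by
    rw [Derivation.leibniz, Derivation.leibniz_pow]
    simp only [smul_eq_mul, nsmul_eq_mul]
    cases e with
    | zero => simp
    | succ e => simp; ring
  rw [key]
  refine sub_mem ?_ (nsmul_mem ?_ _)
  · rw [show s + (m + 1) = m + (s + 1) by ring]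
    exact mul_mem_box hD (h _ _ hg)
  · rw [show s + (m + 1) = m + 1 + s by ring]
    exact mul_mem_box (h _ _ hD) hg

theorem IsBoxDerivation.pow_mul_iterate_mem
    {δ : Derivation R (Laurent₂ R)⟦X⟧ (Laurent₂ R)⟦X⟧}
    (h : IsBoxDerivation δ) {D g : (Laurent₂ R)⟦X⟧} {e s m : ℕ} (hD : D ∈ box R m)
    (hg : D ^ e * g ∈ box R s) (k : ℕ) : D ^ (e + k) * δ^[k] g ∈ box R (s + k * (m + 1)) := by
  induction k with
  | zero => simpa using hg
  | succ k ih =>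
    rw [Function.iterate_succ_apply', ← add_assoc, add_mul, one_mul, ← add_assoc]
    exact h.pow_mul_mem hD ih

end Boxes

section Residue

variable {R : Type*} [CommRing R]

/-- The series `t^i ∂t^j ∂x^k ∂y^l g`, where `p = (i, j, k, l)`. -/
noncomputable def diffMonomial (g : (Laurent₂ R)⟦X⟧) (p : ℕ × ℕ × ℕ × ℕ) : (Laurent₂ R)⟦X⟧ :=
  X ^ p.1 * (tDeriv R)^[p.2.1] ((laurentDeriv (.fst ℤ ℤ) (-1, 0))^[p.2.2.1]
    ((laurentDeriv (.snd ℤ ℤ) (0, -1))^[p.2.2.2] g))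

theorem diffMonomial_mem_box {D g : (Laurent₂ R)⟦X⟧} {m n : ℕ} (hD : D ∈ box R m)
    (hg : D * g ∈ box R m) {p : ℕ × ℕ × ℕ × ℕ} (h1 : p.1 ≤ n) (h2 : p.2.1 ≤ n) (h3 : p.2.2.1 ≤ n)
    (h4 : p.2.2.2 ≤ n) :
    D ^ (1 + 3 * n) * diffMonomial g p ∈ box R (4 * (m + 1) * (n + 1)) := by
  obtain ⟨i, j, k, l⟩ := p
  dsimp only at h1 h2 h3 h4
  have hy := (isBoxDerivation_laurentDeriv (R := R) (.snd ℤ ℤ) (e := (0, -1)) (by simp)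
    (by simp)).pow_mul_iterate_mem hD (e := 1) (by simpa using hg) l
  have hx := (isBoxDerivation_laurentDeriv (R := R) (.fst ℤ ℤ) (e := (-1, 0)) (by simp)
    (by simp)).pow_mul_iterate_mem hD hy k
  have ht := isBoxDerivation_tDeriv.pow_mul_iterate_mem hD hx j
  have hX : (X : (Laurent₂ R)⟦X⟧) ^ i ∈ box R i := by
    simpa [mono_zero] using monomial_mem_box (R := R) (k := i) (n := i) (m := 0)
  have h := mul_mem_box (mul_mem_box hX (pow_mem_box hD (3 * n - (l + k + j)))) ht
  rw [show D ^ (1 + 3 * n) * diffMonomial g (i, j, k, l) = X ^ i * D ^ (3 * n - (l + k + j)) *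
    (D ^ (1 + l + k + j) * (tDeriv R)^[j] ((laurentDeriv (.fst ℤ ℤ) (-1, 0))^[k]
    ((laurentDeriv (.snd ℤ ℤ) (0, -1))^[l] g))) by
      rw [show 1 + 3 * n = 3 * n - (l + k + j) + (1 + l + k + j) by omega, pow_add, diffMonomial]
      ring]
  refine box_mono ?_ h
  obtain ⟨q, hq⟩ : ∃ q, 3 * n - (l + k + j) = q := ⟨_, rfl⟩
  rw [hq]
  have : q + (l + k + j) = 3 * n := by omega
  nlinarith

theorem ncard_boxMonomials_le (n : ℕ) : (boxMonomials R n).ncard ≤ (2 * n + 1) ^ 3 := by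
  refine (Set.ncard_image_le (Finset.finite_toSet _)).trans ?_
  rw [Set.ncard_coe_finset]
  simp only [Finset.card_product, Finset.card_range, Int.card_Icc]
  rw [show ((n : ℤ) + 1 - -n).toNat = 2 * n + 1 by omega]
  nlinarith [Nat.zero_le ((2 * n + 1) ^ 2 * n)]

/-- The dimension count of Lipshitz: a rational function is annihilated by a nonzero
differential operator in `t, ∂t, ∂x, ∂y`. -/
theorem exists_annihilator [Nontrivial R] {D g : (Laurent₂ R)⟦X⟧} {m : ℕ} (hu : IsUnit D)
    (hD : D ∈ box R m) (hg : D * g ∈ box R m) :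
    ∃ n : ℕ, ∃ c : Fin (n + 1) × Fin (n + 1) × Fin (n + 1) × Fin (n + 1) → R, (∃ p, c p ≠ 0) ∧
      ∑ p, c p • diffMonomial g (p.1, p.2.1, p.2.2.1, p.2.2.2) = 0 := by
  set n := (9 * (m + 1)) ^ 3 with hn
  refine ⟨n, ?_⟩
  set v : Fin (n + 1) × Fin (n + 1) × Fin (n + 1) × Fin (n + 1) → (Laurent₂ R)⟦X⟧ :=
    fun p => D ^ (1 + 3 * n) * diffMonomial g (p.1, p.2.1, p.2.2.1, p.2.2.2) with hv
  have hdep : ¬ LinearIndependent R v := fun hli => by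
    have hfin : (boxMonomials R (4 * (m + 1) * (n + 1))).Finite :=
      (Finset.finite_toSet _).image _
    have := hfin.fintype
    have hcard := linearIndependent_le_span' v hli (boxMonomials R (4 * (m + 1) * (n + 1))) (by
      rintro _ ⟨p, rfl⟩
      exact diffMonomial_mem_box hD hg (by dsimp; omega) (by dsimp; omega) (by dsimp; omega)
        (by dsimp; omega))
    rw [← Nat.card_eq_fintype_card, Nat.card_coe_set_eq, Cardinal.mk_fintype, Nat.cast_le] at hcard
    simp only [Fintype.card_prod, Fintype.card_fin] at hcard
    have h1 := hcard.trans (ncard_boxMonomials_le _)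
    have h2 : (2 * (4 * (m + 1) * (n + 1)) + 1) ^ 3 ≤ (9 * (m + 1) * (n + 1)) ^ 3 := by
      gcongr
      nlinarith
    have h3 : (9 * (m + 1) * (n + 1)) ^ 3 = n * (n + 1) ^ 3 := by rw [mul_pow, hn]
    have h4 := Nat.pos_of_ne_zero (pow_ne_zero 3 (Nat.succ_ne_zero n))
    simp only [Nat.succ_eq_add_one] at h4
    nlinarith
  obtain ⟨c, hc, hp⟩ := Fintype.not_linearIndependent_iff.1 hdep
  refine ⟨c, hp, ?_⟩
  simp only [hv, ← mul_smul_comm, ← Finset.mul_sum] at hc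
  exact ((hu.pow _).mul_right_eq_zero).1 hc

theorem extract_iterate_tDeriv (m : ℤ × ℤ) (j : ℕ) (g : (Laurent₂ R)⟦X⟧) :
    extract m ((tDeriv R)^[j] g) = (derivative R)^[j] (extract m g) := by
  induction j with
  | zero => rfl
  | succ j ih => rw [Function.iterate_succ_apply', Function.iterate_succ_apply', ← ih]
                 exact extract_derivative _ _

theorem extract_iterate_laurentDeriv (w : ℤ × ℤ →+ ℤ) (e m : ℤ × ℤ) (k : ℕ)
    (g : (Laurent₂ R)⟦X⟧) : extract m ((laurentDeriv w e)^[k] g) =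
      (∏ i ∈ Finset.range k, w (m - (i + 1) • e)) • extract (m - k • e) g := by
  induction k generalizing g with
  | zero => simp
  | succ k ih =>
    rw [Function.iterate_succ_apply, ih, extract_laurentDeriv, smul_smul, Finset.prod_range_succ,
      show m - k • e - e = m - (k + 1) • e by rw [add_smul, one_smul]; abel]

theorem extract_diffMonomial (g : (Laurent₂ R)⟦X⟧) (i j k l k₀ l₀ : ℕ) :
    extract (-1 - k₀, -1 - l₀) (diffMonomial g (i, j, k, l)) =
      ((∏ s ∈ Finset.range k, ((s : ℤ) - k₀)) * ∏ s ∈ Finset.range l, ((s : ℤ) - l₀)) •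
        (X ^ i * (derivative R)^[j] (extract (-1 - k₀ + k, -1 - l₀ + l) g)) := by
  rw [diffMonomial, extract_X_pow_mul, extract_iterate_tDeriv, extract_iterate_laurentDeriv,
    extract_iterate_laurentDeriv]
  have hz : ∀ (j : ℕ) (z : ℤ) (f : R⟦X⟧),
      (derivative R)^[j] (z • f) = z • (derivative R)^[j] f := fun j z f => by
    induction j with
    | zero => rfl
    | succ j ih => rw [Function.iterate_succ_apply', ih, map_zsmul, Function.iterate_succ_apply']
  rw [smul_smul, hz, mul_smul_comm]
  have hk (s : ℕ) : (AddMonoidHom.fst ℤ ℤ) ((-1 - (k₀ : ℤ), -1 - (l₀ : ℤ)) - (s + 1) • (-1, 0)) =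
      (s : ℤ) - k₀ := by simp; ring
  have hl (s : ℕ) : (AddMonoidHom.snd ℤ ℤ) ((-1 - (k₀ : ℤ), -1 - (l₀ : ℤ)) - k • (-1, 0) -
      (s + 1) • (0, -1)) = (s : ℤ) - l₀ := by simp; ring
  have hm : (-1 - (k₀ : ℤ), -1 - (l₀ : ℤ)) - k • (-1, 0) - l • (0, -1) =
      (-1 - (k₀ : ℤ) + k, -1 - (l₀ : ℤ) + l) := by ext <;> simp
  simp only [hk, hl, hm]

theorem prod_range_sub_ne_zero (k : ℕ) : ∏ s ∈ Finset.range k, ((s : ℤ) - k) ≠ 0 :=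
  Finset.prod_ne_zero_iff.2 fun s hs => by
    rw [Finset.mem_range] at hs
    omega

theorem prod_range_sub_eq_zero {k k₀ : ℕ} (h : k₀ < k) :
    ∏ s ∈ Finset.range k, ((s : ℤ) - k₀) = 0 :=
  Finset.prod_eq_zero (Finset.mem_range.2 h) (sub_self _)

/-- The residue of a rational function of `x, y, t` is D-finite. -/
theorem isDFinite_extract [IsDomain R] [CharZero R] {D g : (Laurent₂ R)⟦X⟧} {m : ℕ}
    (hu : IsUnit D) (hD : D ∈ box R m) (hg : D * g ∈ box R m) :
    IsDFinite (extract (-1, -1) g) := by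
  classical
  obtain ⟨n, c, ⟨q, hq⟩, hc⟩ := exists_annihilator hu hD hg
  obtain ⟨⟨i₀, j₀, k₀, l₀⟩, h₀, hmin⟩ := Finset.exists_min_image
    (Finset.univ.filter fun p => c p ≠ 0)
    (fun p => toLex ((p.2.2.1 : ℕ), (p.2.2.2 : ℕ))) ⟨q, by simpa using hq⟩
  simp only [Finset.mem_filter, Finset.mem_univ, true_and] at h₀ hmin
  set K : ℤ := (∏ s ∈ Finset.range k₀, ((s : ℤ) - k₀)) * ∏ s ∈ Finset.range l₀, ((s : ℤ) - l₀)
    with hK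
  have hK0 : (K : R) ≠ 0 :=
    Int.cast_ne_zero.2 (mul_ne_zero (prod_range_sub_ne_zero _) (prod_range_sub_ne_zero _))
  refine ⟨n, fun j => ∑ i : Fin (n + 1), Polynomial.monomial i (K * c (i, j, k₀, l₀)),
    ⟨j₀, fun h => ?_⟩, ?_⟩
  · have := congr_arg (Polynomial.coeff · i₀) h
    simp only [Polynomial.finsetSum_coeff, Polynomial.coeff_monomial, Fin.val_inj,
      Finset.sum_ite_eq', Finset.mem_univ, if_true, Polynomial.coeff_zero] at this
    exact mul_ne_zero hK0 h₀ this
  · have key (i j k l : Fin (n + 1)) : extract (-1 - (k₀ : ℤ), -1 - (l₀ : ℤ))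
        (c (i, j, k, l) • diffMonomial g (i, j, k, l)) =
        if k = k₀ ∧ l = l₀ then (K * c (i, j, k₀, l₀)) •
          (X ^ (i : ℕ) * (derivative R)^[j] (extract (-1, -1) g)) else 0 := by
      rw [map_smul, extract_diffMonomial]
      split_ifs with hkl
      · obtain ⟨rfl, rfl⟩ := hkl
        rw [mul_comm (K : R), mul_smul _ (K : R), Int.cast_smul_eq_zsmul, hK, sub_add_cancel, sub_add_cancel]
      · by_cases hz : c (i, j, k, l) = 0
        · rw [hz, zero_smul]
        · have := hmin _ hz
          rw [Prod.Lex.toLex_le_toLex] at this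
          rcases this with h | ⟨h, h'⟩
          · rw [prod_range_sub_eq_zero h, zero_mul, zero_smul, smul_zero]
          · have h2 : (l₀ : ℕ) < l := lt_of_le_of_ne h' fun h' =>
              hkl ⟨Fin.ext h.symm, Fin.ext h'.symm⟩
            rw [prod_range_sub_eq_zero h2, mul_zero, zero_smul, smul_zero]
    have := congr_arg (extract (-1 - (k₀ : ℤ), -1 - (l₀ : ℤ))) hc
    rw [map_zero, map_sum] at this
    rw [← this]
    simp only [Fintype.sum_prod_type, key, ite_and]
    simp only [Finset.sum_ite_eq', Finset.mem_univ, if_true, Finset.sum_ite_irrel,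
      Finset.sum_const_zero]
    rw [Finset.sum_comm]
    refine Finset.sum_congr rfl fun j _ => ?_
    rw [← Polynomial.coeToPowerSeries.ringHom_apply, map_sum, Finset.sum_mul]
    refine Finset.sum_congr rfl fun i _ => ?_
    rw [Polynomial.coeToPowerSeries.ringHom_apply, Polynomial.coe_monomial,
      PowerSeries.monomial_eq_C_mul_X_pow, PowerSeries.smul_eq_C_mul, mul_assoc]
    rfl

end Residue

section Kernel

variable {R : Type*} [CommRing R]

/-- `1 - r t ∑ x^e`, the sum over the steps `e ∈ S`. -/
noncomputable def kernel (r : R) (S : Finset (ℤ × ℤ)) : (Laurent₂ R)⟦X⟧ :=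
  1 - r • (X * ∑ e ∈ S, mono R e)

theorem isUnit_kernel (r : R) (S : Finset (ℤ × ℤ)) : IsUnit (kernel r S) := by
  rw [PowerSeries.isUnit_iff_constantCoeff, kernel, ← mul_smul_comm, map_sub, map_one, map_mul,
    constantCoeff_X, zero_mul, sub_zero]
  exact isUnit_one

theorem extract_kernel_mul (r : R) (S : Finset (ℤ × ℤ)) (m : ℤ × ℤ) (g : (Laurent₂ R)⟦X⟧) :
    extract m (kernel r S * g) = extract m g - r • (X * ∑ e ∈ S, extract (m - e) g) := by
  rw [kernel, sub_mul, one_mul, map_sub, smul_mul_assoc, map_smul, mul_assoc, extract_X_mul,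
    Finset.sum_mul, map_sum]
  simp only [extract_mono_mul]

theorem eq_zero_of_recurrence {S : Finset (ℤ × ℤ)} {P : ℤ × ℤ → Prop}
    (hP : ∀ m, P m → ∀ e ∈ S, P (m - e)) {r : R} {d : ℤ × ℤ → R⟦X⟧}
    (hd : ∀ m, P m → d m = r • (X * ∑ e ∈ S, d (m - e))) (m : ℤ × ℤ) (hm : P m) : d m = 0 := by
  ext n
  induction n generalizing m with
  | zero => rw [hd m hm, map_smul, coeff_zero_X_mul, smul_zero, map_zero]
  | succ n ih =>
    rw [hd m hm, map_smul, coeff_succ_X_mul, map_sum,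
      Finset.sum_eq_zero fun e he => ih _ (hP m hm e he), smul_zero, map_zero]

/-- If `K` is a kernel whose step set is invariant under `τ`, and the coefficients of `K g` are
invariant under `τ`, then so are those of `g`. -/
theorem extract_symm {S : Finset (ℤ × ℤ)} (τ : ℤ × ℤ ≃+ ℤ × ℤ) (hτ : S.map τ.toEquiv.toEmbedding = S)
    (r : R) {g : (Laurent₂ R)⟦X⟧}
    (h : ∀ m, extract (τ m) (kernel r S * g) = extract m (kernel r S * g)) (m : ℤ × ℤ) :
    extract (τ m) g = extract m g := by
  rw [← sub_eq_zero]
  refine eq_zero_of_recurrence (S := S) (P := fun _ => True) (fun _ _ _ _ => trivial) (r := r)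
    (d := fun m => extract (τ m) g - extract m g) (fun m _ => ?_) m trivial
  have hs : ∑ e ∈ S, extract (τ m - e) g = ∑ e ∈ S, extract (τ (m - e)) g := by
    conv_lhs => rw [← hτ, Finset.sum_map]
    simp
  have := h m
  rw [extract_kernel_mul, extract_kernel_mul, hs] at this
  rw [Finset.sum_sub_distrib, mul_sub, smul_sub]
  linear_combination this

/-- The steps of the simple walk. -/
def steps : Finset (ℤ × ℤ) := {(1, 0), (-1, 0), (0, 1), (0, -1)}

/-- The steps of the simple walk other than the west step. -/
def eastSteps : Finset (ℤ × ℤ) := {(1, 0), (0, 1), (0, -1)}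

theorem sum_steps {A : Type*} [AddCommMonoid A] (f : ℤ × ℤ → A) :
    ∑ e ∈ steps, f e = f (1, 0) + (f (-1, 0) + (f (0, 1) + f (0, -1))) := by
  simp [steps]

theorem sum_eastSteps {A : Type*} [AddCommMonoid A] (f : ℤ × ℤ → A) :
    ∑ e ∈ eastSteps, f e = f (1, 0) + (f (0, 1) + f (0, -1)) := by
  simp [eastSteps]

/-- The series `1 + t (1/x - x) / K`, `K` being the kernel of the simple walk. -/
noncomputable def reflectionSeries (R : Type*) [CommRing R] : (Laurent₂ R)⟦X⟧ :=
  1 + X * ((mono R (-1, 0) - mono R (1, 0)) * Ring.inverse (kernel 1 steps))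

/-- The rational function whose coefficients are the Green function of the half plane `i ≥ 0`
with weight `b` on the line `i = 0`. -/
noncomputable def greenSeries (b : R) : (Laurent₂ R)⟦X⟧ :=
  Ring.inverse (kernel b eastSteps) * reflectionSeries R

theorem kernel_mul_greenSeries (b : R) :
    kernel b eastSteps * greenSeries b = reflectionSeries R := by
  rw [greenSeries, ← mul_assoc, Ring.mul_inverse_cancel _ (isUnit_kernel _ _), one_mul]

theorem kernel_mul_reflectionSeries :
    kernel 1 steps * reflectionSeries R =
      kernel 1 steps + X * (mono R (-1, 0) - mono R (1, 0)) := by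
  rw [reflectionSeries, mul_add, mul_one]
  linear_combination (X * (mono R (-1, 0) - mono R (1, 0))) *
    Ring.mul_inverse_cancel _ (isUnit_kernel (1 : R) steps)

/-- The reflection `x ↦ 1/x` on exponents. -/
def flipX : ℤ × ℤ ≃+ ℤ × ℤ := (AddEquiv.neg ℤ).prodCongr (AddEquiv.refl ℤ)

/-- The reflection `y ↦ 1/y` on exponents. -/
def flipY : ℤ × ℤ ≃+ ℤ × ℤ := (AddEquiv.refl ℤ).prodCongr (AddEquiv.neg ℤ)

theorem extract_inverse_kernel_symm (τ : ℤ × ℤ ≃+ ℤ × ℤ)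
    (hτ : steps.map τ.toEquiv.toEmbedding = steps) (m : ℤ × ℤ) :
    extract (τ m) (Ring.inverse (kernel (1 : R) steps)) =
      extract m (Ring.inverse (kernel (1 : R) steps)) := by
  refine extract_symm τ hτ 1 (fun m => ?_) m
  rw [Ring.mul_inverse_cancel _ (isUnit_kernel _ _), ← mono_zero, extract_mono, extract_mono]
  simp

theorem extract_reflectionSeries (m : ℤ × ℤ) : extract m (reflectionSeries R) =
    (if m = 0 then 1 else 0) + X * (extract (m - (-1, 0)) (Ring.inverse (kernel (1 : R) steps)) -
      extract (m - (1, 0)) (Ring.inverse (kernel (1 : R) steps))) := by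
  rw [reflectionSeries, map_add, extract_X_mul, sub_mul, map_sub, extract_mono_mul,
    extract_mono_mul, ← mono_zero, extract_mono]

theorem extract_reflectionSeries_zero (j : ℤ) :
    extract (0, j) (reflectionSeries R) = if j = 0 then 1 else 0 := by
  have h : extract (-1, j) (Ring.inverse (kernel (1 : R) steps)) = extract (1, j) _ :=
    extract_inverse_kernel_symm flipX (by decide) (1, j)
  rw [extract_reflectionSeries]
  simp [h]

theorem extract_reflectionSeries_neg (i j : ℤ) :
    extract (i, -j) (reflectionSeries R) = extract (i, j) (reflectionSeries R) := by
  have h (i : ℤ) : extract (i, -j) (Ring.inverse (kernel (1 : R) steps)) = extract (i, j) _ :=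
    extract_inverse_kernel_symm flipY (by decide) (i, j)
  rw [extract_reflectionSeries, extract_reflectionSeries]
  simp [h]

theorem extract_greenSeries_neg (b : R) (i j : ℤ) :
    extract (i, -j) (greenSeries b) = extract (i, j) (greenSeries b) := by
  refine extract_symm (S := eastSteps) flipY (by decide) b (fun m => ?_) (i, j)
  rw [kernel_mul_greenSeries]
  exact extract_reflectionSeries_neg m.1 m.2

theorem extract_greenSeries_zero (b : R) (j : ℤ) :
    extract (0, j) (greenSeries b) = (if j = 0 then 1 else 0) +
      C b * (X * (extract (-1, j) (greenSeries b) +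
        (extract (0, j + 1) (greenSeries b) + extract (0, j - 1) (greenSeries b)))) := by
  have h := extract_kernel_mul b eastSteps (0, j) (greenSeries b)
  rw [kernel_mul_greenSeries, extract_reflectionSeries_zero, sum_eastSteps] at h
  simp [smul_eq_C_mul] at h
  linear_combination -h

theorem extract_inverse_kernel_eastSteps (b : R) {m : ℤ × ℤ} (hm : m.1 < 0) :
    extract m (Ring.inverse (kernel b eastSteps)) = 0 := by
  refine eq_zero_of_recurrence (S := eastSteps) (P := fun m => m.1 < 0) ?_ (r := b)
    (d := fun m => extract m (Ring.inverse (kernel b eastSteps))) (fun m hm => ?_) m hm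
  · intro m hm e he
    simp [eastSteps] at he
    rcases he with rfl | rfl | rfl <;> simp <;> omega
  · rw [← sub_eq_zero, ← extract_kernel_mul, Ring.mul_inverse_cancel _ (isUnit_kernel _ _),
      ← mono_zero, extract_mono, if_neg]
    rintro rfl
    simp at hm

theorem extract_greenSeries_of_neg (b : R) {i : ℤ} (hi : i < 0) (j : ℤ) :
    extract (i, j) (greenSeries b) = X * (extract (i - 1, j) (greenSeries b) +
      (extract (i + 1, j) (greenSeries b) + (extract (i, j + 1) (greenSeries b) +
        extract (i, j - 1) (greenSeries b)))) := by
  have h := extract_kernel_mul 1 steps (i, j) (greenSeries b)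
  have h0 : extract (i, j) (kernel 1 steps * greenSeries b) = 0 := by
    set h := Ring.inverse (kernel b eastSteps) with hh
    have : kernel 1 steps * greenSeries b =
        h - X * (mono R (0, 1) * h + mono R (0, -1) * h + 2 • (mono R (1, 0) * h)) := by
      rw [greenSeries, mul_left_comm, kernel_mul_reflectionSeries, ← hh, kernel, sum_steps, one_smul]
      ring
    rw [this]
    simp only [map_sub, map_add, extract_X_mul, extract_mono_mul, map_nsmul]
    rw [extract_inverse_kernel_eastSteps b (by simpa using hi),
      extract_inverse_kernel_eastSteps b (by simpa using hi),
      extract_inverse_kernel_eastSteps b (by simpa using hi),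
      extract_inverse_kernel_eastSteps b (by simp; omega)]
    simp
  rw [h0, sum_steps] at h
  simp at h
  linear_combination -h

theorem isGreen_extract_greenSeries (b : R) : IsGreen 1 b 1 fun i j =>
    extract (-i, j) (greenSeries b) - extract (-i, j + 2) (greenSeries b) := by
  intro i j
  have hj (i : ℤ) : extract (i, -1) (greenSeries b) = extract (i, 1) (greenSeries b) :=
    extract_greenSeries_neg b i 1
  have e1 (n : ℕ) : (n : ℤ) + 1 + 2 - 1 = n + 2 := by ring
  have e2 (n : ℕ) : (n : ℤ) + 1 + 2 + 1 = n + 1 + 1 + 2 := by ring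
  have e3 (n : ℕ) : -1 + -(n : ℤ) - 1 = -1 + (-1 + -n) := by ring
  have e4 (n : ℕ) : (n : ℤ) + 1 ≠ 0 := by omega
  have e5 (n : ℕ) : (n : ℤ) + 1 + 2 ≠ 0 := by omega
  rcases i with _ | i
  · have h1 := extract_greenSeries_zero b j
    have h2 := extract_greenSeries_zero b (j + 2)
    rcases j with _ | j <;> simp [nbrSum, bdryWeight, hj, e1, e2, e4, e5] at h1 h2 ⊢ <;>
      linear_combination h1 - h2
  · have h1 := extract_greenSeries_of_neg b (i := -(i + 1 : ℕ)) (by omega) j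
    have h2 := extract_greenSeries_of_neg b (i := -(i + 1 : ℕ)) (by omega) (j + 2)
    rcases j with _ | j <;> simp [nbrSum, bdryWeight, hj, e1, e2, e3] at h1 h2 ⊢ <;>
      linear_combination h1 - h2

end Kernel

section DFinite

variable {R : Type*} [CommRing R]

/-- The algebra of Laurent polynomials in `x, y` with polynomial dependence on `t`. -/
noncomputable def laurentSubalgebra (R : Type*) [CommRing R] :
    Subalgebra R (Laurent₂ R)⟦X⟧ where
  carrier := {g | ∃ n, g ∈ box R n}
  mul_mem' := fun ⟨n, hf⟩ ⟨n', hg⟩ => ⟨n + n', mul_mem_box hf hg⟩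
  add_mem' := fun ⟨_, hf⟩ ⟨_, hg⟩ => ⟨_, add_mem (box_mono (le_max_left _ _) hf)
    (box_mono (le_max_right _ _) hg)⟩
  algebraMap_mem' r := ⟨0, by
    rw [Algebra.algebraMap_eq_smul_one]; exact Submodule.smul_mem _ r one_mem_box⟩

theorem X_mem_laurentSubalgebra : X ∈ laurentSubalgebra R :=
  ⟨1, by simpa [mono_zero] using monomial_mem_box (R := R) (k := 1) (n := 1) (m := 0)⟩

theorem mono_mem_laurentSubalgebra (m : ℤ × ℤ) : mono R m ∈ laurentSubalgebra R :=
  ⟨(|m.1| + |m.2|).toNat, by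
    simpa using monomial_mem_box (R := R) (k := 0) (n := (|m.1| + |m.2|).toNat) (m := m)
      (Nat.zero_le _) (by have := abs_nonneg m.2; omega) (by have := abs_nonneg m.1; omega)⟩

theorem kernel_mem_laurentSubalgebra (r : R) (S : Finset (ℤ × ℤ)) :
    kernel r S ∈ laurentSubalgebra R :=
  sub_mem (one_mem _) (Subalgebra.smul_mem _ (mul_mem X_mem_laurentSubalgebra
    (sum_mem fun e _ => mono_mem_laurentSubalgebra e)) _)

theorem isDFinite_extract_of_mem [IsDomain R] [CharZero R] {D g : (Laurent₂ R)⟦X⟧}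
    (hu : IsUnit D) (hD : D ∈ laurentSubalgebra R) (hg : D * g ∈ laurentSubalgebra R) :
    IsDFinite (extract (-1, -1) g) := by
  obtain ⟨n, hn⟩ := hD
  obtain ⟨n', hn'⟩ := hg
  exact isDFinite_extract hu (box_mono (le_max_left n n') hn) (box_mono (le_max_right n n') hn')

/-- The generating function of the quarter-plane loops of the simple walk, with weight `b` on the
line `i = 0`. -/
noncomputable def sideGF (b : R) : R⟦X⟧ :=
  extract (0, 0) (greenSeries b) - extract (0, 2) (greenSeries b)

theorem extract_mul_greenSeries (b : R) :
    extract (-1, -1) ((mono R (-1, -1) - mono R (-1, -3)) * greenSeries b) = sideGF b := by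
  rw [sub_mul, map_sub, extract_mono_mul, extract_mono_mul]
  rfl

theorem isDFinite_combination [IsDomain R] [CharZero R] (a b p q s u v : R) :
    IsDFinite (C p + C q * X ^ 2 + C s * X ^ 2 * (C u * sideGF a + C v * sideGF b)) := by
  set W : (Laurent₂ R)⟦X⟧ := kernel 1 steps + X * (mono R (-1, 0) - mono R (1, 0)) with hW
  set M : (Laurent₂ R)⟦X⟧ := mono R (-1, -1) - mono R (-1, -3) with hM
  have ha : kernel 1 steps * kernel a eastSteps * greenSeries a = W := by
    rw [mul_assoc, kernel_mul_greenSeries, kernel_mul_reflectionSeries]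
  have hb : kernel 1 steps * kernel b eastSteps * greenSeries b = W := by
    rw [mul_assoc, kernel_mul_greenSeries, kernel_mul_reflectionSeries]
  set D : (Laurent₂ R)⟦X⟧ := kernel 1 steps * kernel a eastSteps * kernel b eastSteps with hD
  set f : (Laurent₂ R)⟦X⟧ := p • mono R (-1, -1) + q • (X ^ 2 * mono R (-1, -1)) +
    s • (X ^ 2 * (u • (M * greenSeries a) + v • (M * greenSeries b))) with hf
  have hex : extract (-1, -1) f =
      C p + C q * X ^ 2 + C s * X ^ 2 * (C u * sideGF a + C v * sideGF b) := by
    simp only [hf, map_add, map_smul, extract_X_pow_mul, hM, extract_mul_greenSeries,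
      extract_mono, if_true, smul_eq_C_mul]
    ring
  have hDf : D * f = p • (D * mono R (-1, -1)) + q • (D * (X ^ 2 * mono R (-1, -1))) +
      s • (X ^ 2 * (u • (M * kernel b eastSteps * W) + v • (M * kernel a eastSteps * W))) := by
    simp only [hf, Algebra.smul_def]
    linear_combination (algebraMap R _ s) * X ^ 2 * algebraMap R _ u * M * kernel b eastSteps * ha +
      (algebraMap R _ s) * X ^ 2 * algebraMap R _ v * M * kernel a eastSteps * hb
  have hDmem : D ∈ laurentSubalgebra R :=
    mul_mem (mul_mem (kernel_mem_laurentSubalgebra _ _) (kernel_mem_laurentSubalgebra _ _))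
      (kernel_mem_laurentSubalgebra _ _)
  have hMmem : M ∈ laurentSubalgebra R :=
    sub_mem (mono_mem_laurentSubalgebra _) (mono_mem_laurentSubalgebra _)
  have hWmem : W ∈ laurentSubalgebra R :=
    add_mem (kernel_mem_laurentSubalgebra _ _) (mul_mem X_mem_laurentSubalgebra
      (sub_mem (mono_mem_laurentSubalgebra _) (mono_mem_laurentSubalgebra _)))
  have hX : X ^ 2 ∈ laurentSubalgebra R := pow_mem X_mem_laurentSubalgebra 2
  rw [← hex]
  refine isDFinite_extract_of_mem (((isUnit_kernel _ _).mul (isUnit_kernel _ _)).mul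
    (isUnit_kernel _ _)) hDmem ?_
  rw [← hD, hDf]
  have hm := mono_mem_laurentSubalgebra (R := R) (-1, -1)
  exact add_mem (add_mem (Subalgebra.smul_mem _ (mul_mem hDmem hm) _)
    (Subalgebra.smul_mem _ (mul_mem hDmem (mul_mem hX hm)) _))
    (Subalgebra.smul_mem _ (mul_mem hX (add_mem
      (Subalgebra.smul_mem _ (mul_mem (mul_mem hMmem (kernel_mem_laurentSubalgebra _ _)) hWmem) _)
      (Subalgebra.smul_mem _ (mul_mem (mul_mem hMmem (kernel_mem_laurentSubalgebra _ _)) hWmem) _))) _)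

theorem sideGF_eq {b : R} {g : ℕ → ℕ → R⟦X⟧} (hg : IsGreen 1 b 1 g) : g 0 0 = sideGF b := by
  have := (isGreen_extract_greenSeries b).unique hg 0 0
  rw [one_mul] at this
  rw [← this]
  rfl

end DFinite

/-- Model 1 (the simple walk): `G(t;a,b)` is a ratio of D-finite series. -/
theorem model1_Gab_ratio_of_dfinite :
    ∃ F H : PowerSeries (MvPolynomial (Fin 2) ℚ),
      IsDFinite F ∧ IsDFinite H ∧ H ≠ 0 ∧
      H * loopGF ({((1:ℤ), (0:ℤ)), (-1, 0), (0, 1), (0, -1)} : Set (ℤ × ℤ))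
        (MvPolynomial.X (0 : Fin 2)) (MvPolynomial.X (1 : Fin 2)) = F := by
  set a : MvPolynomial (Fin 2) ℚ := MvPolynomial.X 0 with ha
  set b : MvPolynomial (Fin 2) ℚ := MvPolynomial.X 1 with hb
  have key := (isGreen_walkWeight a b).mul_eq (isGreen_walkWeight 1 b) (isGreen_walkWeight 1 a)
  rw [sideGF_eq (isGreen_walkWeight 1 a), sideGF_eq (isGreen_walkWeight 1 b)] at key
  refine ⟨C ((a - 1) * (b - 1)) + C 0 * X ^ 2 +
      C (-(a * b)) * X ^ 2 * (C (a - 1) * sideGF a + C (b - 1) * sideGF b),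
    C ((a - 1) * (b - 1)) + C (-(a * b * (a * (b - 1) + b * (a - 1)))) * X ^ 2 +
      C (-(a * b * ((a - 1) * (b - 1)))) * X ^ 2 * (C (a - 1) * sideGF a + C (b - 1) * sideGF b),
    isDFinite_combination .., isDFinite_combination .., fun h => ?_, ?_⟩
  · have h0 := congr_arg constantCoeff h
    simp only [map_add, map_mul, map_pow, constantCoeff_X, constantCoeff_C] at h0
    have h1 := congr_arg (MvPolynomial.eval fun _ => (2 : ℚ)) h0
    norm_num [ha, hb] at h1
  · rw [loopGF_eq]
    simp only [map_neg, map_zero]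
    linear_combination key
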